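/- Let Λ ⊂ ℝⁿ be a full-rank lattice and let Λ* be its polar lattice. Then for every 1 ≤ i ≤ n, λ_i(Λ) · λ_{n+1-i}(Λ*) ≤ n, where λ_i(Λ) = λ_i(B_n, Λ) denotes the i-th successive minimum of Λ with respect to the Euclidean unit ball B_n. -/

import Mathlib

open MeasureTheory Pointwise

/-- The lattice `Bℤⁿ ⊆ ℝⁿ` generated by the (invertible) matrix `B`. -/
def latticeOf {n : ℕ} (B : Matrix (Fin n) (Fin n) ℝ) : Set (Fin n → ℝ) :=
  {x | ∃ z : Fin n → ℤ, x = B.mulVec (fun i => (z i : ℝ))}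

/-- The `j`-th successive minimum of a set `K ⊆ ℝⁿ` with respect to a set of
lattice points `Λ ⊆ ℝⁿ`: the infimum of all `λ > 0` such that `λ • K` contains
at least `j` linearly independent points of `Λ`. -/
noncomputable def succMin {n : ℕ} (K Λ : Set (Fin n → ℝ)) (j : ℕ) : ℝ :=
  sInf {lam : ℝ | 0 < lam ∧ ∃ v : Fin j → (Fin n → ℝ),
    LinearIndependent ℝ v ∧ ∀ k, v k ∈ Λ ∧ v k ∈ lam • K}

/-- The polar lattice `Λ* = {y : ⟨x, y⟩ ∈ ℤ for all x ∈ Λ}`. -/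
def polarLattice {n : ℕ} (Λ : Set (Fin n → ℝ)) : Set (Fin n → ℝ) :=
  {y | ∀ x ∈ Λ, ∃ k : ℤ, (∑ i, x i * y i) = (k : ℝ)}

lemma summable_exp_neg_mul_add_sq {d : ℝ} (hd : 0 < d) (m : ℝ) :
    Summable fun n : ℤ => Real.exp (-Real.pi * (d * (n + m) ^ 2)) := by
  have h := (summable_jacobiTheta₂_term_iff (Complex.I * (d * m)) (Complex.I * d)).2 (by simpa)
  refine (h.norm.mul_left (Real.exp (-Real.pi * (d * m ^ 2)))).congr fun n => ?_
  rw [norm_jacobiTheta₂_term, ← Real.exp_add]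
  congr 1
  simp
  ring

lemma tsum_exp_neg_mul_add_sq_mul_cexp {d : ℝ} (hd : 0 < d) (m w : ℝ) :
    ∑' n : ℤ, (Real.exp (-Real.pi * (d * (n + m) ^ 2)) : ℂ) *
        Complex.exp (-(2 * Real.pi * Complex.I * (w * n))) =
      ((Real.sqrt d)⁻¹ : ℝ) * ∑' k : ℤ, (Real.exp (-Real.pi * ((k + w) ^ 2 / d)) : ℂ) *
        Complex.exp (2 * Real.pi * Complex.I * (m * (k + w))) := by
  have hd' : (d : ℂ) ≠ 0 := by exact_mod_cast hd.ne'
  have key := Complex.tsum_exp_neg_quadratic (a := d) (by simpa) (-d * m - Complex.I * w)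
  have h1 : (1 : ℂ) / (d : ℂ) ^ (1 / 2 : ℂ) = ((Real.sqrt d)⁻¹ : ℝ) := by
    rw [Real.sqrt_eq_rpow, Complex.ofReal_inv, Complex.ofReal_cpow hd.le]
    simp
  rw [h1] at key
  calc _ = ∑' n : ℤ, Complex.exp (-Real.pi * d * m ^ 2) *
        Complex.exp (-Real.pi * d * n ^ 2 + 2 * Real.pi * (-d * m - Complex.I * w) * n) := by
        congr 1 with n
        push_cast
        rw [← Complex.exp_add, ← Complex.exp_add]
        congr 1
        ring
    _ = _ := by
        rw [tsum_mul_left, key, mul_left_comm, ← tsum_mul_left]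
        congr 2 with n
        push_cast
        rw [← Complex.exp_add, ← Complex.exp_add]
        congr 1
        have : ((n : ℂ) + Complex.I * (-d * m - Complex.I * w)) ^ 2 =
          (n + w) ^ 2 - 2 * Complex.I * d * m * (n + w) - d ^ 2 * m ^ 2 := by
          have hI : Complex.I * (-d * m - Complex.I * w) = w - Complex.I * d * m := by
            linear_combination (-w : ℂ) * Complex.I_sq
          rw [hI]
          linear_combination (d ^ 2 * m ^ 2 : ℂ) * Complex.I_sq
        rw [this]
        field_simp
        ring

/-- Gaussians `exp (-π q)` and `exp (-π q')` on `ℝⁿ` related by Poisson summation over `ℤⁿ`,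
with `c` the reciprocal covolume. -/
structure PoissonPair (n : ℕ) (q q' : (Fin n → ℝ) → ℝ) (c : ℝ) : Prop where
  pos : 0 < c
  summable_left : Summable fun z : Fin n → ℤ => Real.exp (-Real.pi * q (fun i => z i))
  summable_right : ∀ w : Fin n → ℝ,
    Summable fun k : Fin n → ℤ => Real.exp (-Real.pi * q' (fun i => k i + w i))
  tsum_eq : ∀ w : Fin n → ℝ,
    ∑' z : Fin n → ℤ, (Real.exp (-Real.pi * q (fun i => z i)) : ℂ) *
        Complex.exp (-(2 * Real.pi * Complex.I * (∑ i, w i * z i : ℝ))) =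
      c * ∑' k : Fin n → ℤ, (Real.exp (-Real.pi * q' (fun i => k i + w i)) : ℂ)

namespace PoissonPair

variable {n : ℕ} {q q' : (Fin n → ℝ) → ℝ} {c : ℝ}

lemma norm_cexp_neg_two_pi_I_mul (x : ℝ) :
    ‖Complex.exp (-(2 * Real.pi * Complex.I * x))‖ = 1 := by
  rw [Complex.norm_exp]; simp

lemma tsum_right_le (h : PoissonPair n q q' c) (w : Fin n → ℝ) :
    ∑' k : Fin n → ℤ, Real.exp (-Real.pi * q' (fun i => k i + w i)) ≤
      c⁻¹ * ∑' z : Fin n → ℤ, Real.exp (-Real.pi * q (fun i => z i)) := by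
  have h1 := h.tsum_eq w
  rw [← Complex.ofReal_tsum, ← Complex.ofReal_mul] at h1
  have h2 : ‖((c * ∑' k : Fin n → ℤ, Real.exp (-Real.pi * q' (fun i => k i + w i)) : ℝ) : ℂ)‖ ≤
      ∑' z : Fin n → ℤ, Real.exp (-Real.pi * q (fun i => z i)) := by
    rw [← h1]
    refine tsum_of_norm_bounded h.summable_left.hasSum fun z => ?_
    rw [norm_mul, norm_cexp_neg_two_pi_I_mul, mul_one, Complex.norm_real, Real.norm_eq_abs,
      Real.abs_exp]
  rw [Complex.norm_real, Real.norm_eq_abs] at h2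
  rw [le_inv_mul_iff₀ h.pos]
  exact (le_abs_self _).trans h2

lemma tsum_eq_real (h : PoissonPair n q q' c) :
    ∑' z : Fin n → ℤ, Real.exp (-Real.pi * q (fun i => z i)) =
      c * ∑' k : Fin n → ℤ, Real.exp (-Real.pi * q' (fun i => k i)) := by
  have := h.tsum_eq 0
  simp only [Pi.zero_apply, zero_mul, Finset.sum_const_zero, Complex.ofReal_zero, mul_zero,
    neg_zero, Complex.exp_zero, mul_one, add_zero] at this
  exact_mod_cast this

lemma zero {q q' : (Fin 0 → ℝ) → ℝ} (hq : ∀ x, q x = 0) (hq' : ∀ x, q' x = 0) :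
    PoissonPair 0 q q' 1 where
  pos := one_pos
  summable_left := (hasSum_fintype _).summable
  summable_right _ := (hasSum_fintype _).summable
  tsum_eq w := by simp [hq, hq']

lemma summable_exp_neg_add_sq_div {d : ℝ} (hd : 0 < d) (w : ℝ) :
    Summable fun k : ℤ => Real.exp (-Real.pi * ((k + w) ^ 2 / d)) :=
  (summable_exp_neg_mul_add_sq (inv_pos.2 hd) w).congr fun k => by rw [div_eq_inv_mul]

lemma summable_cons_left (h : PoissonPair n q q' c) {d : ℝ} (hd : 0 < d) (l : Fin n → ℝ) :
    Summable fun p : (Fin n → ℤ) × ℤ =>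
      Real.exp (-Real.pi * (d * (p.2 + ∑ i, l i * p.1 i) ^ 2 + q (fun i => p.1 i))) := by
  rw [summable_prod_of_nonneg fun _ => (Real.exp_pos _).le]
  simp only [mul_add (-Real.pi), Real.exp_add]
  refine ⟨fun z => (summable_exp_neg_mul_add_sq hd _).mul_right _, ?_⟩
  simp only [tsum_mul_right]
  refine Summable.of_nonneg_of_le (fun z => mul_nonneg (tsum_nonneg fun _ => (Real.exp_pos _).le)
    (Real.exp_pos _).le) (fun z => mul_le_mul_of_nonneg_right (?_ : _ ≤ (Real.sqrt d)⁻¹ * ∑' k : ℤ,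
      Real.exp (-Real.pi * ((k + (0 : ℝ)) ^ 2 / d))) (Real.exp_pos _).le) (h.summable_left.mul_left _)
  have h1 := tsum_exp_neg_mul_add_sq_mul_cexp hd (∑ i, l i * z i) 0
  have h2 : ∑' n : ℤ, Real.exp (-Real.pi * (d * (n + ∑ i, l i * z i) ^ 2)) =
      ‖((Real.sqrt d)⁻¹ : ℝ) * ∑' k : ℤ, (Real.exp (-Real.pi * ((k + (0:ℝ)) ^ 2 / d)) : ℂ) *
      Complex.exp (2 * Real.pi * Complex.I * ((∑ i, l i * z i : ℝ) * (k + (0 : ℝ))))‖ := by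
    rw [← h1]
    simp only [Complex.ofReal_zero, zero_mul, mul_zero, neg_zero, Complex.exp_zero, mul_one]
    rw [← Complex.ofReal_tsum, Complex.norm_real, Real.norm_of_nonneg
      (tsum_nonneg fun _ => (Real.exp_pos _).le)]
  rw [h2, norm_mul, Complex.norm_real, Real.norm_of_nonneg (inv_pos.2 (Real.sqrt_pos.2 hd)).le]
  refine mul_le_mul_of_nonneg_left ?_ (inv_pos.2 (Real.sqrt_pos.2 hd)).le
  refine tsum_of_norm_bounded (summable_exp_neg_add_sq_div hd 0).hasSum fun k => ?_
  rw [norm_mul, Complex.norm_real, Real.norm_eq_abs, Real.abs_exp, Complex.norm_exp]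
  simp

lemma summable_cons_right (h : PoissonPair n q q' c) {d : ℝ} (hd : 0 < d) (l : Fin n → ℝ)
    (w : Fin (n + 1) → ℝ) :
    Summable fun p : ℤ × (Fin n → ℤ) =>
      Real.exp (-Real.pi * ((p.1 + w 0) ^ 2 / d +
        q' (fun i => p.2 i + (w i.succ - (p.1 + w 0) * l i)))) := by
  rw [summable_prod_of_nonneg fun _ => (Real.exp_pos _).le]
  simp only [mul_add (-Real.pi), Real.exp_add]
  refine ⟨fun z => (h.summable_right _).mul_left _, ?_⟩
  simp only [tsum_mul_left]
  exact Summable.of_nonneg_of_le (fun z => mul_nonneg (Real.exp_pos _).le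
    (tsum_nonneg fun _ => (Real.exp_pos _).le))
    (fun z => mul_le_mul_of_nonneg_left (h.tsum_right_le _) (Real.exp_pos _).le)
    ((summable_exp_neg_add_sq_div hd _).mul_right _)

lemma tsum_cons_inner (q : (Fin n → ℝ) → ℝ) {d : ℝ} (hd : 0 < d) (l : Fin n → ℝ)
    (w : Fin (n + 1) → ℝ) (z : Fin n → ℤ) :
    ∑' m : ℤ, (Real.exp (-Real.pi * (d * (m + ∑ i, l i * z i) ^ 2 + q (fun i => z i))) : ℂ) *
        Complex.exp (-(2 * Real.pi * Complex.I * (w 0 * m + ∑ i, w i.succ * z i : ℝ))) =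
      ((Real.sqrt d)⁻¹ : ℝ) * ∑' k : ℤ, (Real.exp (-Real.pi * q (fun i => z i)) : ℂ) *
        ((Real.exp (-Real.pi * ((k + w 0) ^ 2 / d)) : ℂ) *
          Complex.exp (-(2 * Real.pi * Complex.I *
            (∑ i, (w i.succ - (k + w 0) * l i) * z i : ℝ)))) := by
  calc _ = ∑' m : ℤ, ((Real.exp (-Real.pi * q (fun i => z i)) : ℂ) * Complex.exp (-(2 * Real.pi * Complex.I *
          (∑ i, w i.succ * z i : ℝ)))) *
        ((Real.exp (-Real.pi * (d * (m + (∑ i, l i * z i : ℝ)) ^ 2)) : ℂ) *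
          Complex.exp (-(2 * Real.pi * Complex.I * (w 0 * m)))) := by
        congr 1 with m
        rw [mul_add (-Real.pi), Real.exp_add]
        push_cast
        rw [mul_add (2 * Real.pi * Complex.I), neg_add, Complex.exp_add]
        ring
    _ = _ := by
        rw [tsum_mul_left, tsum_exp_neg_mul_add_sq_mul_cexp hd, mul_left_comm, ← tsum_mul_left]
        congr 2 with k
        have : Complex.exp (-(2 * Real.pi * Complex.I *
            (∑ i, (w i.succ - (k + w 0) * l i) * z i : ℝ))) = Complex.exp (-(2 * Real.pi * Complex.I *
            (∑ i, w i.succ * z i : ℝ))) * Complex.exp (2 * Real.pi * Complex.I *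
            ((∑ i, l i * z i : ℝ) * (k + w 0))) := by
          rw [← Complex.exp_add]
          simp only [sub_mul, Finset.sum_sub_distrib, mul_assoc, ← Finset.mul_sum]
          congr 1
          push_cast
          ring
        rw [this]
        ring

/-- Poisson summation passes through the addition of one coordinate to a triangularized form. -/
lemma cons (h : PoissonPair n q q' c) {d : ℝ} (hd : 0 < d) (l : Fin n → ℝ) :
    PoissonPair (n + 1) (fun x => d * (x 0 + ∑ i, l i * x i.succ) ^ 2 + q (fun i => x i.succ))
      (fun k => k 0 ^ 2 / d + q' (fun i => k i.succ - k 0 * l i)) ((Real.sqrt d)⁻¹ * c) := by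
  set e : (Fin n → ℤ) × ℤ ≃ (Fin (n + 1) → ℤ) :=
    (Equiv.prodComm _ _).trans (Fin.consEquiv fun _ => ℤ) with he
  have e0 : ∀ p, e p 0 = p.2 := fun p => rfl
  have es : ∀ p i, e p (Fin.succ i) = p.1 i := fun p i => rfl
  refine ⟨mul_pos (inv_pos.2 (Real.sqrt_pos.2 hd)) h.pos, ?_, fun w => ?_, fun w => ?_⟩
  · rw [← e.summable_iff]
    exact h.summable_cons_left hd l
  · rw [← (Fin.consEquiv fun _ => ℤ).summable_iff]
    refine (h.summable_cons_right hd l w).congr fun p => ?_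
    simp [Fin.consEquiv, add_sub_assoc]
  · set Q : (Fin n → ℤ) → ℝ := fun z => Real.exp (-Real.pi * q (fun i => z i))
    set G : ℤ → ℝ := fun k => Real.exp (-Real.pi * ((k + w 0) ^ 2 / d))
    set E : ℤ → (Fin n → ℤ) → ℂ := fun k z =>
      Complex.exp (-(2 * Real.pi * Complex.I *
        (∑ i, (w i.succ - (k + w 0) * l i) * z i : ℝ)))
    have hleft : Summable fun p : (Fin n → ℤ) × ℤ =>
        (Real.exp (-Real.pi * (d * (p.2 + ∑ i, l i * p.1 i) ^ 2 + q (fun i => p.1 i))) : ℂ) *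
          Complex.exp (-(2 * Real.pi * Complex.I *
            (w 0 * p.2 + ∑ i, w i.succ * p.1 i : ℝ))) := by
      refine .of_norm ((h.summable_cons_left hd l).congr fun p => ?_)
      rw [norm_mul, norm_cexp_neg_two_pi_I_mul, mul_one, Complex.norm_real, Real.norm_eq_abs,
        Real.abs_exp]
    have hmid : Summable fun p : (Fin n → ℤ) × ℤ => (Q p.1 : ℂ) * (G p.2 * E p.2 p.1) := by
      refine .of_norm (((h.summable_left.mul_of_nonneg (summable_exp_neg_add_sq_div hd (w 0)) (fun _ => (Real.exp_pos _).le)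
        fun _ => (Real.exp_pos _).le)).congr fun p => ?_)
      rw [norm_mul, norm_mul, norm_cexp_neg_two_pi_I_mul, mul_one, Complex.norm_real,
        Complex.norm_real, Real.norm_eq_abs, Real.abs_exp, Real.norm_eq_abs, Real.abs_exp]
    have hcomplex := Complex.summable_ofReal.2 (h.summable_cons_right hd l w)
    calc _ = ∑' p : (Fin n → ℤ) × ℤ,
          (Real.exp (-Real.pi * (d * (p.2 + ∑ i, l i * p.1 i) ^ 2 + q (fun i => p.1 i))) : ℂ) *
          Complex.exp (-(2 * Real.pi * Complex.I *
            (w 0 * p.2 + ∑ i, w i.succ * p.1 i : ℝ))) := by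
          rw [← e.tsum_eq]
          simp only [e0, es, Fin.sum_univ_succ]
      _ = ∑' z : Fin n → ℤ, ((Real.sqrt d)⁻¹ : ℝ) * ∑' k : ℤ, (Q z : ℂ) * (G k * E k z) := by
          rw [hleft.tsum_prod]
          exact tsum_congr fun z => tsum_cons_inner q hd l w z
      _ = ((Real.sqrt d)⁻¹ : ℝ) * ∑' k : ℤ, ∑' z : Fin n → ℤ, (Q z : ℂ) * (G k * E k z) := by
          rw [tsum_mul_left, Summable.tsum_comm (f := fun z k => (Q z : ℂ) * (G k * E k z)) hmid]
      _ = ((Real.sqrt d)⁻¹ : ℝ) * ∑' k : ℤ, (c : ℂ) * ∑' j : Fin n → ℤ,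
          (Real.exp (-Real.pi * ((k + w 0) ^ 2 / d +
            q' (fun i => j i + (w i.succ - (k + w 0) * l i)))) : ℂ) := by
          congr 2 with k
          have h2 := h.tsum_eq (fun i => w i.succ - (k + w 0) * l i)
          calc _ = (G k : ℂ) * ∑' z, (Q z : ℂ) * E k z := by
                rw [← tsum_mul_left]
                exact tsum_congr fun z => by ring
            _ = _ := by
                rw [h2, mul_left_comm, ← tsum_mul_left]
                congr 2 with j
                rw [mul_add (-Real.pi), Real.exp_add, Complex.ofReal_mul]
      _ = _ := by
          rw [tsum_mul_left, ← hcomplex.tsum_prod, ← (Fin.consEquiv fun _ => ℤ).tsum_eq,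
            ← mul_assoc, ← Complex.ofReal_mul]
          congr 2 with p
          simp [Fin.consEquiv, add_sub_assoc]

end PoissonPair

/-- The Schur complement of the top left entry. -/
noncomputable def schurTail {n : ℕ} (S : Matrix (Fin (n + 1)) (Fin (n + 1)) ℝ) :
    Matrix (Fin n) (Fin n) ℝ :=
  Matrix.of fun i j => S i.succ j.succ - S i.succ 0 * (S 0 j.succ / S 0 0)

section schurTail

open Matrix

variable {n : ℕ} {S : Matrix (Fin (n + 1)) (Fin (n + 1)) ℝ}

lemma mulVec_zero_eq (h0 : S 0 0 ≠ 0) (x : Fin (n + 1) → ℝ) :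
    (S *ᵥ x) 0 = S 0 0 * (x 0 + ∑ i : Fin n, S 0 i.succ / S 0 0 * x i.succ) := by
  rw [mulVec, dotProduct, Fin.sum_univ_succ, mul_add, Finset.mul_sum]
  congr 1
  refine Finset.sum_congr rfl fun i _ => ?_
  field_simp

lemma schurTail_mulVec (h0 : S 0 0 ≠ 0) (hS : S.IsSymm) (x : Fin (n + 1) → ℝ) (i : Fin n) :
    (schurTail S *ᵥ fun j => x j.succ) i =
      (S *ᵥ x) i.succ - (S *ᵥ x) 0 * (S 0 i.succ / S 0 0) := by
  rw [mulVec_zero_eq h0, mulVec, mulVec, dotProduct, dotProduct, Fin.sum_univ_succ]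
  simp only [schurTail, of_apply, sub_mul, Finset.sum_sub_distrib, mul_assoc, ← Finset.mul_sum]
  rw [hS.apply 0 i.succ]
  generalize ∑ j : Fin n, S 0 j.succ / S 0 0 * x j.succ = m
  field_simp
  ring

lemma dotProduct_mulVec_eq_schurTail (h0 : S 0 0 ≠ 0) (hS : S.IsSymm) (x : Fin (n + 1) → ℝ) :
    x ⬝ᵥ S *ᵥ x = S 0 0 * (x 0 + ∑ i : Fin n, S 0 i.succ / S 0 0 * x i.succ) ^ 2 +
      (fun i => x i.succ) ⬝ᵥ schurTail S *ᵥ (fun i => x i.succ) := by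
  have h1 : (fun i => x i.succ) ⬝ᵥ schurTail S *ᵥ (fun i => x i.succ) =
      (∑ i : Fin n, x i.succ * (S *ᵥ x) i.succ) -
        (S *ᵥ x) 0 * ∑ i : Fin n, S 0 i.succ / S 0 0 * x i.succ := by
    rw [dotProduct, Finset.mul_sum, ← Finset.sum_sub_distrib]
    refine Finset.sum_congr rfl fun i _ => ?_
    rw [schurTail_mulVec h0 hS]
    ring
  rw [h1, mulVec_zero_eq h0, dotProduct, Fin.sum_univ_succ, mulVec_zero_eq h0]
  ring

lemma det_eq_mul_det_schurTail (h0 : S 0 0 ≠ 0) : S.det = S 0 0 * (schurTail S).det := by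
  rw [det_eq_of_forall_row_eq_smul_add_const (A := S)
    (B := of fun i j => S i j - (Fin.cons 0 (fun k => S k.succ 0 / S 0 0) : Fin (n + 1) → ℝ) i *
      S 0 j) (Fin.cons 0 (fun k => S k.succ 0 / S 0 0)) 0 (by simp) (by intro i j; simp),
    det_succ_column_zero, Fin.sum_univ_succ, Finset.sum_eq_zero]
  · simp only [schurTail]
    simp
    left
    congr 1
    ext i j
    simp
    ring
  · intro i _
    simp [h0]

lemma Matrix.PosDef.schurTail (hS : S.PosDef) : (schurTail S).PosDef := by
  have h0 : S 0 0 ≠ 0 := hS.diag_pos.ne'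
  have hs : S.IsSymm := by simpa using hS.isHermitian
  refine .of_dotProduct_mulVec_pos ?_ fun x hx => ?_
  · ext i j
    simp only [_root_.schurTail, conjTranspose_apply, of_apply, star_trivial]
    rw [hs.apply i.succ j.succ, hs.apply 0 j.succ, hs.apply i.succ 0]
    ring
  · have h1 := dotProduct_mulVec_eq_schurTail h0 hs
      (Fin.cons (-∑ i, S 0 i.succ / S 0 0 * x i) x : Fin (n + 1) → ℝ)
    simp only [Fin.cons_zero, Fin.cons_succ, neg_add_cancel] at h1
    have h2 := hS.dotProduct_mulVec_pos
      (x := (Fin.cons (-∑ i, S 0 i.succ / S 0 0 * x i) x : Fin (n + 1) → ℝ)) (by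
        contrapose! hx
        ext i
        simpa using congrFun hx i.succ)
    rw [star_trivial, h1] at h2
    simpa using h2

lemma dotProduct_inv_mulVec_eq_schurTail (hS : S.PosDef) (k : Fin (n + 1) → ℝ) :
    k ⬝ᵥ S⁻¹ *ᵥ k = k 0 ^ 2 / S 0 0 +
      (fun i => k i.succ - k 0 * (S 0 i.succ / S 0 0)) ⬝ᵥ
        (schurTail S)⁻¹ *ᵥ (fun i => k i.succ - k 0 * (S 0 i.succ / S 0 0)) := by
  have h0 : S 0 0 ≠ 0 := hS.diag_pos.ne'
  have hs : S.IsSymm := by simpa using hS.isHermitian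
  have hu : IsUnit S.det := (isUnit_iff_isUnit_det _).1 hS.isUnit
  have hu' : IsUnit (schurTail S).det := (isUnit_iff_isUnit_det _).1 hS.schurTail.isUnit
  obtain ⟨x, rfl⟩ : ∃ x, k = S *ᵥ x := ⟨S⁻¹ *ᵥ k, by
    rw [mulVec_mulVec, mul_nonsing_inv _ hu, one_mulVec]⟩
  have h1 : (fun i : Fin n => (S *ᵥ x) i.succ - (S *ᵥ x) 0 * (S 0 i.succ / S 0 0)) =
      schurTail S *ᵥ fun j => x j.succ := by
    ext i
    rw [schurTail_mulVec h0 hs]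
  rw [h1, mulVec_mulVec, mulVec_mulVec, nonsing_inv_mul _ hu, nonsing_inv_mul _ hu', one_mulVec,
    one_mulVec, dotProduct_comm, dotProduct_mulVec_eq_schurTail h0 hs, mulVec_zero_eq h0,
    dotProduct_comm (schurTail S *ᵥ _)]
  congr 1
  field_simp

end schurTail

/-- Poisson summation for a positive definite quadratic form on `ℤⁿ`. -/
lemma Matrix.PosDef.poissonPair {n : ℕ} {S : Matrix (Fin n) (Fin n) ℝ} (hS : S.PosDef) :
    PoissonPair n (fun x => x ⬝ᵥ S.mulVec x) (fun k => k ⬝ᵥ S⁻¹.mulVec k) (Real.sqrt S.det)⁻¹ := by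
  induction n with
  | zero => simpa using PoissonPair.zero (by simp) (by simp)
  | succ n ih =>
    have h0 : 0 < S 0 0 := hS.diag_pos
    have hs : S.IsSymm := by simpa using hS.isHermitian
    have h := (ih hS.schurTail).cons h0 fun i => S 0 i.succ / S 0 0
    simp only [dotProduct_mulVec_eq_schurTail h0.ne' hs, dotProduct_inv_mulVec_eq_schurTail hS,
      det_eq_mul_det_schurTail h0.ne', Real.sqrt_mul h0.le, mul_inv]
    exact h

lemma mul_exp_neg_mul_le {b N x : ℝ} (hN : 0 < N) (hb : 1 ≤ b * N) (hx : N ≤ x) :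
    x * Real.exp (-(b * x)) ≤ N * Real.exp (-(b * N)) := by
  have h1 : x ≤ N * Real.exp (b * (x - N)) := by
    have := Real.add_one_le_exp (b * (x - N))
    nlinarith [mul_nonneg (sub_nonneg.2 hb) (sub_nonneg.2 hx)]
  calc x * Real.exp (-(b * x)) ≤ N * Real.exp (b * (x - N)) * Real.exp (-(b * x)) :=
        mul_le_mul_of_nonneg_right h1 (Real.exp_pos _).le
    _ = N * Real.exp (-(b * N)) := by
        rw [mul_assoc, ← Real.exp_add]; ring_nf

lemma exp_sub_le_exp_neg_add {N q p s ε : ℝ} (hN : 0 < N) (hs : 1 ≤ Real.pi * (1 - s) * N)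
    (hε : 0 ≤ ε) (hpq : p ^ 2 ≤ q) (hp : p ≠ 0 → N ≤ q) :
    Real.exp (-Real.pi * q) - Real.pi * ε * (N * Real.exp (-(Real.pi * (1 - s) * N))) *
      Real.exp (-Real.pi * (s * q)) ≤ Real.exp (-Real.pi * (q + ε * p ^ 2)) := by
  have hpi := Real.pi_pos
  rcases eq_or_ne p 0 with rfl | h
  · have : 0 ≤ Real.pi * ε * (N * Real.exp (-(Real.pi * (1 - s) * N))) *
      Real.exp (-Real.pi * (s * q)) := by positivity
    simpa using this
  · have h1 := mul_exp_neg_mul_le hN hs (hp h)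
    have h2 : q * Real.exp (-Real.pi * q) ≤ N * Real.exp (-(Real.pi * (1 - s) * N)) *
        Real.exp (-Real.pi * (s * q)) := by
      refine le_trans (le_of_eq ?_) (mul_le_mul_of_nonneg_right h1 (Real.exp_pos _).le)
      rw [mul_assoc, ← Real.exp_add]; ring_nf
    have h3 : 1 - Real.pi * ε * q ≤ Real.exp (-Real.pi * (ε * p ^ 2)) := by
      have := Real.add_one_le_exp (-Real.pi * (ε * p ^ 2))
      nlinarith [mul_le_mul_of_nonneg_left hpq (mul_nonneg hpi.le hε)]
    rw [mul_add, Real.exp_add]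
    have h4 := mul_le_mul_of_nonneg_left h3 (Real.exp_pos (-Real.pi * q)).le
    have h5 := mul_le_mul_of_nonneg_left h2 (mul_nonneg hpi.le hε)
    nlinarith

lemma exp_neg_sub_le_exp_add {N q p s δ : ℝ} (hN : 0 < N) (hs : 1 ≤ Real.pi * (1 - δ - s) * N)
    (hδ : 0 ≤ δ) (hpq : p ^ 2 ≤ q) (hp : p ≠ 0 → N ≤ q) :
    Real.exp (-Real.pi * (q - δ * p ^ 2)) ≤ Real.exp (-Real.pi * q) +
      Real.pi * δ * (N * Real.exp (-(Real.pi * (1 - δ - s) * N))) *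
      Real.exp (-Real.pi * (s * q)) := by
  have hpi := Real.pi_pos
  rcases eq_or_ne p 0 with rfl | h
  · have : 0 ≤ Real.pi * δ * (N * Real.exp (-(Real.pi * (1 - δ - s) * N))) *
      Real.exp (-Real.pi * (s * q)) := by positivity
    simpa using this
  · have h1 := mul_exp_neg_mul_le hN hs (hp h)
    have h2 : q * Real.exp (-Real.pi * (q - δ * q)) ≤
        N * Real.exp (-(Real.pi * (1 - δ - s) * N)) * Real.exp (-Real.pi * (s * q)) := by
      refine le_trans (le_of_eq ?_) (mul_le_mul_of_nonneg_right h1 (Real.exp_pos _).le)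
      rw [mul_assoc, ← Real.exp_add]; ring_nf
    have h3 : Real.exp (-Real.pi * (q - δ * p ^ 2)) ≤ Real.exp (-Real.pi * (q - δ * q)) := by
      refine Real.exp_le_exp.2 ?_
      nlinarith [mul_le_mul_of_nonneg_left hpq (mul_nonneg hpi.le hδ)]
    have h4 : Real.exp (-Real.pi * (q - δ * q)) * (1 - Real.pi * δ * q) ≤
        Real.exp (-Real.pi * q) := by
      have h6 := Real.add_one_le_exp (-Real.pi * (δ * q))
      calc _ ≤ Real.exp (-Real.pi * (q - δ * q)) * Real.exp (-Real.pi * (δ * q)) :=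
            mul_le_mul_of_nonneg_left (by linarith) (Real.exp_pos _).le
        _ = _ := by rw [← Real.exp_add]; ring_nf
    have h5 := mul_le_mul_of_nonneg_left h2 (mul_nonneg hpi.le hδ)
    nlinarith

section theta

open Matrix

variable {n : ℕ} {S : Matrix (Fin n) (Fin n) ℝ}

/-- The theta series `∑ exp (-π zᵀSz)` over `z ∈ ℤⁿ`. -/
noncomputable def latticeTheta (S : Matrix (Fin n) (Fin n) ℝ) : ℝ :=
  ∑' z : Fin n → ℤ, Real.exp (-Real.pi * ((fun i => (z i : ℝ)) ⬝ᵥ S *ᵥ fun i => (z i : ℝ)))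

lemma Matrix.PosDef.summable_theta (hS : S.PosDef) : Summable fun z : Fin n → ℤ =>
    Real.exp (-Real.pi * ((fun i => (z i : ℝ)) ⬝ᵥ S *ᵥ fun i => (z i : ℝ))) :=
  hS.poissonPair.summable_left

lemma Matrix.PosDef.latticeTheta_pos (hS : S.PosDef) : 0 < latticeTheta S :=
  hS.summable_theta.tsum_pos (fun _ => (Real.exp_pos _).le) 0 (Real.exp_pos _)

lemma Matrix.PosDef.latticeTheta_eq (hS : S.PosDef) :
    latticeTheta S = (Real.sqrt S.det)⁻¹ * latticeTheta S⁻¹ :=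
  hS.poissonPair.tsum_eq_real

lemma Matrix.PosDef.inv_smul (hS : S.PosDef) {s : ℝ} (hs : 0 < s) :
    (s • S)⁻¹ = s⁻¹ • S⁻¹ := by
  refine inv_eq_right_inv ?_
  rw [smul_mul_smul_comm, mul_inv_cancel₀ hs.ne',
    mul_nonsing_inv _ ((isUnit_iff_isUnit_det _).1 hS.isUnit), one_smul]

lemma Matrix.PosDef.latticeTheta_smul_le (hS : S.PosDef) {s : ℝ} (hs : 0 < s) (hs1 : s ≤ 1) :
    latticeTheta (s • S) ≤ (Real.sqrt (s ^ n))⁻¹ * latticeTheta S := by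
  rw [(hS.smul hs).latticeTheta_eq, hS.latticeTheta_eq, det_smul, Fintype.card_fin,
    Real.sqrt_mul (by positivity), mul_inv, mul_assoc, hS.inv_smul hs]
  refine mul_le_mul_of_nonneg_left (mul_le_mul_of_nonneg_left ?_ (by positivity)) (by positivity)
  refine (hS.inv.smul (inv_pos.2 hs)).summable_theta.tsum_le_tsum (fun z => ?_)
    hS.inv.summable_theta
  refine Real.exp_le_exp.2 ?_
  have h := hS.inv.posSemidef.dotProduct_mulVec_nonneg (fun i => (z i : ℝ))
  rw [star_trivial] at h
  rw [smul_mulVec, dotProduct_smul, smul_eq_mul]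
  have h1 := (one_le_inv₀ hs).2 hs1
  nlinarith [mul_nonneg (sub_nonneg.2 h1) h, mul_nonneg Real.pi_pos.le (mul_nonneg (sub_nonneg.2 h1) h)]

variable {u : Fin n → ℝ}

lemma dotProduct_mulVec_add_smul_vecMulVec (S : Matrix (Fin n) (Fin n) ℝ) (ε : ℝ)
    (v x : Fin n → ℝ) :
    x ⬝ᵥ (S + ε • vecMulVec v v) *ᵥ x = x ⬝ᵥ S *ᵥ x + ε * (x ⬝ᵥ v) ^ 2 := by
  rw [add_mulVec, dotProduct_add, smul_mulVec, dotProduct_smul, vecMulVec_mulVec]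
  simp [dotProduct_comm v x]
  left
  ring

lemma Matrix.PosDef.add_smul_vecMulVec (hS : S.PosDef) {ε : ℝ} (hε : 0 ≤ ε) (v : Fin n → ℝ) :
    (S + ε • vecMulVec v v).PosDef := by
  refine hS.add_posSemidef (PosSemidef.smul ?_ hε)
  simpa using posSemidef_vecMulVec_self_star v

lemma Matrix.PosDef.inv_add_smul_vecMulVec (hS : S.PosDef) (hu : u ⬝ᵥ S *ᵥ u = 1) {ε : ℝ}
    (hε : 0 ≤ ε) :
    (S + ε • vecMulVec (S *ᵥ u) (S *ᵥ u))⁻¹ = S⁻¹ + (-(ε / (1 + ε))) • vecMulVec u u := by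
  have hs : S.IsSymm := by simpa using hS.isHermitian
  have hd : IsUnit S.det := (isUnit_iff_isUnit_det _).1 hS.isUnit
  have h1 : (S *ᵥ u) ᵥ* S⁻¹ = u := by
    rw [← hs, mulVec_transpose, hs, vecMul_vecMul, mul_nonsing_inv _ hd, vecMul_one]
  refine inv_eq_right_inv ?_
  rw [add_mul, mul_add, mul_add, mul_nonsing_inv _ hd, smul_mul_assoc, smul_mul_assoc,
    mul_smul_comm, mul_smul_comm, vecMulVec_mul, h1, mul_vecMulVec, vecMulVec_mul_vecMulVec,
    dotProduct_comm, hu, one_smul, smul_smul, add_assoc, ← add_smul, ← add_smul]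
  have : -(ε / (1 + ε)) + (ε + ε * -(ε / (1 + ε))) = 0 := by
    have : 1 + ε ≠ 0 := by positivity
    field_simp
    ring
  rw [this, zero_smul, add_zero]

lemma det_add_smul_vecMulVec_mulVec (hu : u ⬝ᵥ S *ᵥ u = 1) (ε : ℝ) :
    (S + ε • vecMulVec (S *ᵥ u) (S *ᵥ u)).det = (1 + ε) * S.det := by
  have : S + ε • vecMulVec (S *ᵥ u) (S *ᵥ u) =
      S * (1 + replicateCol Unit u * replicateRow Unit (ε • S *ᵥ u)) := by
    rw [mul_add, mul_one, ← vecMulVec_eq, mul_vecMulVec, vecMulVec_smul]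
  rw [this, det_mul, det_one_add_replicateCol_mul_replicateRow, smul_dotProduct, dotProduct_comm,
    hu]
  simp [mul_comm]

lemma Matrix.PosDef.sq_dotProduct_mulVec_le (hS : S.PosDef) (hu : u ⬝ᵥ S *ᵥ u = 1)
    (x : Fin n → ℝ) : (x ⬝ᵥ S *ᵥ u) ^ 2 ≤ x ⬝ᵥ S *ᵥ x := by
  have hs : S.IsSymm := by simpa using hS.isHermitian
  have h := hS.posSemidef.dotProduct_mulVec_nonneg (x - (x ⬝ᵥ S *ᵥ u) • u)
  have h1 : u ⬝ᵥ S *ᵥ x = x ⬝ᵥ S *ᵥ u := by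
    rw [dotProduct_mulVec, ← hs, vecMul_transpose, hs, dotProduct_comm]
  simp only [star_trivial, mulVec_sub, mulVec_smul, sub_dotProduct, dotProduct_sub,
    smul_dotProduct, dotProduct_smul, smul_eq_mul, h1, hu] at h
  linarith

end theta

lemma nat_mul_pow_le {y : ℝ} (hy : 0 ≤ y) (hy1 : y ≤ 1 / 2) {n : ℕ} (hn : 2 ≤ n) :
    n * y ^ n ≤ 2 * y ^ 2 := by
  induction n, hn using Nat.le_induction with
  | base => norm_num
  | succ n hn ih =>
    have h2 : (2 : ℝ) ≤ n := by exact_mod_cast hn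
    have h3 : ((n + 1 : ℕ) : ℝ) * y ≤ n := by push_cast; nlinarith
    calc ((n + 1 : ℕ) : ℝ) * y ^ (n + 1) = ((n + 1 : ℕ) : ℝ) * y * y ^ n := by ring
      _ ≤ n * y ^ n := mul_le_mul_of_nonneg_right h3 (by positivity)
      _ ≤ _ := ih

lemma nat_mul_exp_mul_inv_sqrt_le {c s : ℝ} (hs : 0 < s) (hc : 4 * s⁻¹ ≤ Real.exp (2 * c))
    {n : ℕ} (hn : 2 ≤ n) :
    n * Real.exp (-(c * n)) * (Real.sqrt (s ^ n))⁻¹ ≤ 2 * (s⁻¹ / Real.exp (2 * c)) := by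
  have hsq : 0 < Real.sqrt s := Real.sqrt_pos.2 hs
  set y := Real.exp (-c) * (Real.sqrt s)⁻¹ with hy
  have hy0 : 0 ≤ y := by positivity
  have hy2 : y ^ 2 = s⁻¹ / Real.exp (2 * c) := by
    rw [hy, mul_pow, inv_pow, Real.sq_sqrt hs.le, ← Real.exp_nat_mul, div_eq_mul_inv,
      ← Real.exp_neg, mul_comm]
    congr 2
    push_cast
    ring
  have hy1 : y ≤ 1 / 2 := by
    refine le_of_sq_le_sq ?_ (by norm_num)
    rw [hy2, div_le_iff₀ (Real.exp_pos _)]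
    linarith
  refine le_trans (le_of_eq ?_) ((nat_mul_pow_le hy0 hy1 hn).trans_eq (by rw [hy2]))
  rw [hy, mul_pow, ← Real.exp_nat_mul, inv_pow, mul_assoc]
  have : Real.sqrt (s ^ n) = Real.sqrt s ^ n := by
    rw [Real.sqrt_eq_iff_mul_self_eq (by positivity) (by positivity), ← mul_pow,
      Real.mul_self_sqrt hs.le]
  rw [this]
  ring_nf

lemma exp_five_mul_pi_div_three_ge : 176 ≤ Real.exp (2 * (Real.pi * (1 - 1 / 6))) := by
  have h1 : (5.23 : ℝ) ≤ 2 * (Real.pi * (1 - 1 / 6)) := by linarith [Real.pi_gt_d4]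
  refine le_trans ?_ (Real.exp_le_exp.2 h1)
  have h2 : (5.23 : ℝ) = (5 : ℕ) * 1 + 0.23 := by norm_num
  rw [h2, Real.exp_add, Real.exp_nat_mul]
  have h3 := Real.quadratic_le_exp_of_nonneg (x := 0.23) (by norm_num)
  have h4 : (2.718 : ℝ) ^ 5 ≤ Real.exp 1 ^ 5 :=
    pow_le_pow_left₀ (by norm_num) (by linarith [Real.exp_one_gt_d9]) 5
  refine le_trans ?_ (mul_le_mul h4 h3 (by norm_num) (by positivity))
  norm_num

lemma exp_two_mul_pi_mul_ge :
    153 ≤ Real.exp (2 * (Real.pi * (1 - 199 / 10000 - 1 / 6))) := by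
  have h1 : (5.11 : ℝ) ≤ 2 * (Real.pi * (1 - 199 / 10000 - 1 / 6)) := by
    linarith [Real.pi_gt_d4]
  refine le_trans ?_ (Real.exp_le_exp.2 h1)
  have h2 : (5.11 : ℝ) = (5 : ℕ) * 1 + 0.11 := by norm_num
  rw [h2, Real.exp_add, Real.exp_nat_mul]
  have h3 := Real.quadratic_le_exp_of_nonneg (x := 0.11) (by norm_num)
  have h4 : (2.718 : ℝ) ^ 5 ≤ Real.exp 1 ^ 5 :=
    pow_le_pow_left₀ (by norm_num) (by linarith [Real.exp_one_gt_d9]) 5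
  refine le_trans ?_ (mul_le_mul h4 h3 (by norm_num) (by positivity))
  norm_num

section theta

open Matrix

variable {n : ℕ} {S : Matrix (Fin n) (Fin n) ℝ} {u : Fin n → ℝ}

lemma Matrix.PosDef.latticeTheta_add_ge (hS : S.PosDef) (hu : u ⬝ᵥ S *ᵥ u = 1) {s ε : ℝ}
    (hn : 0 < n) (hs0 : 0 < s) (hs1 : s ≤ 1) (hs : 1 ≤ Real.pi * (1 - s) * n) (hε : 0 ≤ ε)
    (h : ∀ z : Fin n → ℤ, (fun i => (z i : ℝ)) ⬝ᵥ S *ᵥ u ≠ 0 →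
      n ≤ (fun i => (z i : ℝ)) ⬝ᵥ S *ᵥ fun i => (z i : ℝ)) :
    (1 - Real.pi * ε * (n * Real.exp (-(Real.pi * (1 - s) * n)) * (Real.sqrt (s ^ n))⁻¹)) *
      latticeTheta S ≤ latticeTheta (S + ε • vecMulVec (S *ᵥ u) (S *ᵥ u)) := by
  set c := Real.pi * ε * (n * Real.exp (-(Real.pi * (1 - s) * n))) with hc
  have hc0 : 0 ≤ c := by have := Real.pi_pos; positivity
  have h1 := hS.summable_theta
  have h2 := (hS.smul hs0).summable_theta.mul_left c
  have h3 := (h1.sub h2).tsum_le_tsum (fun z => ?_) (hS.add_smul_vecMulVec hε (S *ᵥ u)).summable_theta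
  · rw [h1.tsum_sub h2, tsum_mul_left] at h3
    change latticeTheta S - c * latticeTheta (s • S) ≤ latticeTheta _ at h3
    nlinarith [mul_le_mul_of_nonneg_left (hS.latticeTheta_smul_le hs0 hs1) hc0]
  · rw [dotProduct_mulVec_add_smul_vecMulVec, smul_mulVec, dotProduct_smul, smul_eq_mul]
    exact exp_sub_le_exp_neg_add (by positivity) hs hε (hS.sq_dotProduct_mulVec_le hu _) (h z)

lemma Matrix.PosDef.latticeTheta_sub_le (hS : S.PosDef) (hu : u ⬝ᵥ S *ᵥ u = 1) {s δ : ℝ}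
    (hn : 0 < n) (hs0 : 0 < s) (hs1 : s ≤ 1) (hs : 1 ≤ Real.pi * (1 - δ - s) * n) (hδ : 0 ≤ δ)
    (hp : (S + (-δ) • vecMulVec (S *ᵥ u) (S *ᵥ u)).PosDef)
    (h : ∀ z : Fin n → ℤ, (fun i => (z i : ℝ)) ⬝ᵥ S *ᵥ u ≠ 0 →
      n ≤ (fun i => (z i : ℝ)) ⬝ᵥ S *ᵥ fun i => (z i : ℝ)) :
    latticeTheta (S + (-δ) • vecMulVec (S *ᵥ u) (S *ᵥ u)) ≤
      (1 + Real.pi * δ * (n * Real.exp (-(Real.pi * (1 - δ - s) * n)) * (Real.sqrt (s ^ n))⁻¹)) *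
      latticeTheta S := by
  set c := Real.pi * δ * (n * Real.exp (-(Real.pi * (1 - δ - s) * n))) with hc
  have hc0 : 0 ≤ c := by have := Real.pi_pos; positivity
  have h1 := hS.summable_theta
  have h2 := (hS.smul hs0).summable_theta.mul_left c
  have h3 := hp.summable_theta.tsum_le_tsum (fun z => ?_) (h1.add h2)
  · rw [h1.tsum_add h2, tsum_mul_left] at h3
    change latticeTheta _ ≤ latticeTheta S + c * latticeTheta (s • S) at h3
    nlinarith [mul_le_mul_of_nonneg_left (hS.latticeTheta_smul_le hs0 hs1) hc0]
  · rw [dotProduct_mulVec_add_smul_vecMulVec, smul_mulVec, dotProduct_smul, smul_eq_mul,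
      neg_mul δ, ← sub_eq_add_neg]
    exact exp_neg_sub_le_exp_add (by positivity) hs hδ (hS.sq_dotProduct_mulVec_le hu _) (h z)

lemma Matrix.PosDef.exists_dotProduct_mulVec_lt (hS : S.PosDef) (hu : u ⬝ᵥ S *ᵥ u = 1)
    (hn : 2 ≤ n)
    (h : ∀ z : Fin n → ℤ, (fun i => (z i : ℝ)) ⬝ᵥ S *ᵥ u ≠ 0 →
      n ≤ (fun i => (z i : ℝ)) ⬝ᵥ S *ᵥ fun i => (z i : ℝ)) :
    ∃ k : Fin n → ℤ, (fun i => (k i : ℝ)) ⬝ᵥ u ≠ 0 ∧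
      (fun i => (k i : ℝ)) ⬝ᵥ S⁻¹ *ᵥ (fun i => (k i : ℝ)) < n := by
  by_contra! h'
  have hd : IsUnit S.det := (isUnit_iff_isUnit_det _).1 hS.isUnit
  have hn2 : (2 : ℝ) ≤ n := by exact_mod_cast hn
  have hpi := Real.pi_gt_d4
  have hpi' := Real.pi_lt_d4
  have hiu : S⁻¹ *ᵥ S *ᵥ u = u := by rw [mulVec_mulVec, nonsing_inv_mul _ hd, one_mulVec]
  have hu' : (S *ᵥ u) ⬝ᵥ S⁻¹ *ᵥ (S *ᵥ u) = 1 := by rw [hiu, dotProduct_comm, hu]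
  have hε : (0 : ℝ) ≤ 199 / 9801 := by norm_num
  have hp := hS.add_smul_vecMulVec hε (S *ᵥ u)
  have hinv := hS.inv_add_smul_vecMulVec hu hε
  have hδ : (199 / 9801 / (1 + 199 / 9801) : ℝ) = 199 / 10000 := by norm_num
  rw [hδ] at hinv
  have h1 := hS.latticeTheta_add_ge hu (s := 1 / 6) (by lia) (by norm_num) (by norm_num)
    (by nlinarith) hε h
  have h2 := hS.inv.latticeTheta_sub_le hu' (s := 1 / 6) (δ := 199 / 10000) (by lia) (by norm_num)
    (by norm_num) (by nlinarith) (by norm_num) (by rw [hiu, ← hinv]; exact hp.inv)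
    (by rw [hiu]; exact h')
  rw [hiu, ← hinv] at h2
  have h3 := hp.latticeTheta_eq
  have hsq : Real.sqrt (1 + 199 / 9801) = 100 / 99 := by
    rw [Real.sqrt_eq_iff_mul_self_eq (by norm_num) (by norm_num)]; norm_num
  rw [det_add_smul_vecMulVec_mulVec hu, Real.sqrt_mul (by norm_num), hsq, mul_inv] at h3
  have h4 := hS.latticeTheta_eq
  have h5 := nat_mul_exp_mul_inv_sqrt_le (s := 1 / 6) (by norm_num)
    (le_trans (by norm_num) exp_five_mul_pi_div_three_ge) hn
  have h6 := nat_mul_exp_mul_inv_sqrt_le (s := 1 / 6) (by norm_num)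
    (le_trans (by norm_num) exp_two_mul_pi_mul_ge) hn
  have h7 : (1 / 6 : ℝ)⁻¹ / Real.exp (2 * (Real.pi * (1 - 1 / 6))) ≤ 6 / 176 := by
    rw [inv_div, div_one]
    exact div_le_div_of_nonneg_left (by norm_num) (by norm_num) exp_five_mul_pi_div_three_ge
  have h8 : (1 / 6 : ℝ)⁻¹ / Real.exp (2 * (Real.pi * (1 - 199 / 10000 - 1 / 6))) ≤ 6 / 153 := by
    rw [inv_div, div_one]
    exact div_le_div_of_nonneg_left (by norm_num) (by norm_num) exp_two_mul_pi_mul_ge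
  generalize (n * Real.exp (-(Real.pi * (1 - 1 / 6) * n)) * (Real.sqrt ((1 / 6) ^ n))⁻¹ : ℝ) = A
    at h1 h5
  generalize (n * Real.exp (-(Real.pi * (1 - 199 / 10000 - 1 / 6) * n)) *
    (Real.sqrt ((1 / 6) ^ n))⁻¹ : ℝ) = B at h2 h6
  have h9 : 0 < (Real.sqrt S.det)⁻¹ := inv_pos.2 (Real.sqrt_pos.2 hS.det_pos)
  have h10 : latticeTheta (S + (199 / 9801 : ℝ) • vecMulVec (S *ᵥ u) (S *ᵥ u)) ≤
      99 / 100 * (1 + Real.pi * (199 / 10000) * B) * latticeTheta S := by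
    rw [h3, h4]
    calc _ ≤ (100 / 99)⁻¹ * (Real.sqrt S.det)⁻¹ * _ :=
          mul_le_mul_of_nonneg_left h2 (by positivity)
      _ = _ := by ring
  have h11 := le_of_mul_le_mul_right (h1.trans h10) hS.latticeTheta_pos
  have hA : Real.pi * A ≤ Real.pi * (12 / 176) :=
    mul_le_mul_of_nonneg_left (by linarith) (by linarith)
  have hB : Real.pi * B ≤ Real.pi * (12 / 153) :=
    mul_le_mul_of_nonneg_left (by linarith) (by linarith)
  linarith

lemma Matrix.PosDef.mul_le_sq_of_forall_le (hS : S.PosDef) (hn : 1 ≤ n) (hu : u ≠ 0) {a b : ℝ}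
    (ha : 0 < a)
    (h : ∀ z : Fin n → ℤ, (fun i => (z i : ℝ)) ⬝ᵥ S *ᵥ u ≠ 0 →
      a ≤ (fun i => (z i : ℝ)) ⬝ᵥ S *ᵥ fun i => (z i : ℝ))
    (h' : ∀ k : Fin n → ℤ, (fun i => (k i : ℝ)) ⬝ᵥ u ≠ 0 →
      b ≤ (fun i => (k i : ℝ)) ⬝ᵥ S⁻¹ *ᵥ fun i => (k i : ℝ)) :
    a * b ≤ n ^ 2 := by
  rcases hn.eq_or_lt with rfl | hn
  · have hu0 : u 0 ≠ 0 := fun h0 => hu (by ext i; rw [Subsingleton.elim i 0, h0]; rfl)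
    have hS0 : 0 < S 0 0 := hS.diag_pos
    have h1 := h (fun _ => 1) (by simp [mulVec, dotProduct, hu0, hS0.ne'])
    have h2 := h' (fun _ => 1) (by simp [dotProduct, hu0])
    have hi : S⁻¹ 0 0 = (S 0 0)⁻¹ := by
      rw [inv_def, adjugate_fin_one, det_fin_one]
      simp
    simp only [mulVec, dotProduct, Finset.univ_unique, Fin.default_eq_zero, Finset.sum_singleton,
      Int.cast_one, one_mul, mul_one, hi] at h1 h2
    calc a * b ≤ a * (S 0 0)⁻¹ := mul_le_mul_of_nonneg_left h2 ha.le
      _ ≤ S 0 0 * (S 0 0)⁻¹ := mul_le_mul_of_nonneg_right h1 (inv_pos.2 hS0).le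
      _ = _ := by rw [mul_inv_cancel₀ hS0.ne']; norm_num
  · have hn0 : (0 : ℝ) < n := by exact_mod_cast (by lia : 0 < n)
    set τ : ℝ := n / a with hτ
    have hτ0 : 0 < τ := by positivity
    have hpos : 0 < u ⬝ᵥ S *ᵥ u := by simpa using hS.dotProduct_mulVec_pos hu
    set c : ℝ := (Real.sqrt (τ * (u ⬝ᵥ S *ᵥ u)))⁻¹ with hc
    have hc0 : 0 < c := inv_pos.2 (Real.sqrt_pos.2 (by positivity))
    obtain ⟨k, hk, hlt⟩ := (hS.smul hτ0).exists_dotProduct_mulVec_lt (u := c • u) (by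
      rw [smul_mulVec, mulVec_smul, smul_dotProduct, dotProduct_smul, dotProduct_smul, smul_eq_mul,
        smul_eq_mul, smul_eq_mul]
      have : c * c * (τ * (u ⬝ᵥ S *ᵥ u)) = 1 := by
        rw [hc, ← mul_inv, Real.mul_self_sqrt (by positivity), inv_mul_cancel₀ (by positivity)]
      linarith) hn fun z hz => by
        rw [smul_mulVec, mulVec_smul, dotProduct_smul, dotProduct_smul] at hz
        have h1 := h z (right_ne_zero_of_mul (right_ne_zero_of_mul hz))
        rw [smul_mulVec, dotProduct_smul, smul_eq_mul]
        calc (n : ℝ) = τ * a := by rw [hτ]; field_simp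
          _ ≤ _ := mul_le_mul_of_nonneg_left h1 hτ0.le
    rw [dotProduct_smul] at hk
    have h2 := h' k (right_ne_zero_of_mul hk)
    rw [hS.inv_smul hτ0, smul_mulVec, dotProduct_smul, smul_eq_mul, inv_mul_lt_iff₀ hτ0] at hlt
    have h3 : b ≤ τ * n := h2.trans hlt.le
    calc a * b ≤ a * (τ * n) := mul_le_mul_of_nonneg_left h3 ha.le
      _ = _ := by rw [hτ]; field_simp

end theta

lemma mem_smul_ball_iff {n : ℕ} {lam : ℝ} (h : 0 < lam) (x : Fin n → ℝ) :
    x ∈ lam • {x : Fin n → ℝ | (∑ j, (x j) ^ 2) ≤ 1} ↔ ∑ j, (x j) ^ 2 ≤ lam ^ 2 := by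
  rw [Set.mem_smul_set_iff_inv_smul_mem₀ h.ne', Set.mem_ofPred_eq]
  simp only [Pi.smul_apply, smul_eq_mul, mul_pow, ← Finset.mul_sum]
  rw [inv_pow, inv_mul_le_iff₀ (by positivity), mul_one]

lemma succMin_nonneg {n : ℕ} (K Λ : Set (Fin n → ℝ)) (j : ℕ) : 0 ≤ succMin K Λ j :=
  Real.sInf_nonneg fun _ h => h.1.le

lemma finrank_span_lt_of_succMin_pos {n : ℕ} (Λ : Set (Fin n → ℝ)) (j : ℕ) {a : ℝ}
    (ha : a = succMin {x : Fin n → ℝ | (∑ j, (x j) ^ 2) ≤ 1} Λ j) (h0 : 0 < a) :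
    Module.finrank ℝ (Submodule.span ℝ {x ∈ Λ | ∑ i, (x i) ^ 2 < a ^ 2}) < j := by
  by_contra! hj
  obtain ⟨v, hv, -, hli⟩ :=
    Submodule.exists_fun_fin_finrank_span_eq ℝ {x ∈ Λ | ∑ i, (x i) ^ 2 < a ^ 2}
  have h1 : ∀ᶠ l in nhdsWithin a (Set.Iio a), ∀ k, ∑ i, (v k i) ^ 2 ≤ l ^ 2 :=
    Filter.eventually_all.2 fun k => Filter.Eventually.mono
      ((((continuous_pow 2).tendsto a).mono_left nhdsWithin_le_nhds).eventually_const_lt (hv k).2)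
      fun _ => le_of_lt
  have h2 : ∀ᶠ l in nhdsWithin a (Set.Iio a), 0 < l :=
    Filter.Eventually.filter_mono nhdsWithin_le_nhds (lt_mem_nhds h0)
  obtain ⟨l, ⟨hl, hl0⟩, hla⟩ := ((h1.and h2).and self_mem_nhdsWithin).exists
  refine (not_le.2 hla) (ha.trans_le (csInf_le ⟨0, fun _ h => h.1.le⟩ ⟨hl0, v ∘ Fin.castLE hj,
    hli.comp _ (Fin.castLE_injective hj), fun k => ⟨(hv _).1, ?_⟩⟩))
  exact (mem_smul_ball_iff hl0 _).2 (hl _)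

open Matrix in
lemma inv_transpose_mulVec_mem_polarLattice {n : ℕ} {B : Matrix (Fin n) (Fin n) ℝ}
    (hB : IsUnit B.det) (k : Fin n → ℤ) :
    (B⁻¹)ᵀ *ᵥ (fun i => (k i : ℝ)) ∈ polarLattice (latticeOf B) := by
  rintro _ ⟨z, rfl⟩
  refine ⟨∑ i, z i * k i, ?_⟩
  change (B *ᵥ _) ⬝ᵥ _ = _
  rw [mulVec_transpose, dotProduct_comm, ← dotProduct_mulVec, mulVec_mulVec, nonsing_inv_mul _ hB,
    one_mulVec, dotProduct_comm]
  simp [dotProduct]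

/-- Banaszczyk's transference bound: For a full-rank lattice
`Λ = Bℤⁿ` with polar lattice `Λ*`, and `1 ≤ i ≤ n`,
`λ_i(Λ) · λ_{n+1-i}(Λ*) ≤ n`, where the successive minima are taken with
respect to the Euclidean unit ball `Bₙ = {x : ∑ x_j² ≤ 1}`. -/
theorem stmt_17 (n : ℕ) (B : Matrix (Fin n) (Fin n) ℝ) (hB : B.det ≠ 0)
    (i : ℕ) (hi1 : 1 ≤ i) (hin : i ≤ n) :
    succMin {x : Fin n → ℝ | (∑ j, (x j) ^ 2) ≤ 1} (latticeOf B) i *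
        succMin {x : Fin n → ℝ | (∑ j, (x j) ^ 2) ≤ 1}
          (polarLattice (latticeOf B)) (n + 1 - i) ≤ (n : ℝ) := by
  open Matrix in
  generalize ha : succMin {x : Fin n → ℝ | (∑ j, (x j) ^ 2) ≤ 1} (latticeOf B) i = a
  generalize hb : succMin {x : Fin n → ℝ | (∑ j, (x j) ^ 2) ≤ 1}
    (polarLattice (latticeOf B)) (n + 1 - i) = b
  have ha0 : 0 ≤ a := ha ▸ succMin_nonneg _ _ _
  have hb0 : 0 ≤ b := hb ▸ succMin_nonneg _ _ _
  rcases ha0.eq_or_lt with rfl | ha0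
  · simp
  rcases hb0.eq_or_lt with rfl | hb0
  · simp
  have h1 := finrank_span_lt_of_succMin_pos _ _ ha.symm ha0
  have h2 := finrank_span_lt_of_succMin_pos _ _ hb.symm hb0
  set M := Submodule.span ℝ {x ∈ latticeOf B | ∑ i, (x i) ^ 2 < a ^ 2}
  set N := Submodule.span ℝ {x ∈ polarLattice (latticeOf B) | ∑ i, (x i) ^ 2 < b ^ 2}
  have hlt : M ⊔ N < ⊤ := by
    refine lt_top_iff_ne_top.2 fun h => ?_
    have h3 := Submodule.finrank_add_le_finrank_add_finrank M N
    rw [h, finrank_top, Module.finrank_fin_fun] at h3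
    lia
  obtain ⟨f, hf, hker⟩ := Submodule.exists_le_ker_of_lt_top _ hlt
  obtain ⟨w, rfl⟩ := (dotProductEquiv ℝ (Fin n)).surjective f
  have hw : w ≠ 0 := fun h => hf (by rw [h, map_zero])
  have hd : IsUnit B.det := hB.isUnit
  have hBw : B *ᵥ B⁻¹ *ᵥ w = w := by rw [mulVec_mulVec, mul_nonsing_inv _ hd, one_mulVec]
  have hM : ∀ x ∈ latticeOf B, x ⬝ᵥ w ≠ 0 → a ^ 2 ≤ x ⬝ᵥ x := by
    intro x hx hxw
    by_contra! hlt
    refine hxw ((dotProduct_comm _ _).trans (hker (Submodule.mem_sup_left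
      (Submodule.subset_span ⟨hx, ?_⟩))))
    simpa [dotProduct, sq] using hlt
  have hN : ∀ x ∈ polarLattice (latticeOf B), x ⬝ᵥ w ≠ 0 → b ^ 2 ≤ x ⬝ᵥ x := by
    intro x hx hxw
    by_contra! hlt
    refine hxw ((dotProduct_comm _ _).trans (hker (Submodule.mem_sup_right
      (Submodule.subset_span ⟨hx, ?_⟩))))
    simpa [dotProduct, sq] using hlt
  have hS : (Bᵀ * B).PosDef := by
    simpa using PosDef.conjTranspose_mul_self B
      (mulVec_injective_iff_isUnit.2 ((isUnit_iff_isUnit_det _).2 hd))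
  have hdot : ∀ x y : Fin n → ℝ, x ⬝ᵥ (Bᵀ * B) *ᵥ y = (B *ᵥ x) ⬝ᵥ (B *ᵥ y) := fun x y => by
    rw [← mulVec_mulVec, dotProduct_mulVec, vecMul_transpose]
  have hdot' : ∀ x : Fin n → ℝ,
      x ⬝ᵥ (Bᵀ * B)⁻¹ *ᵥ x = ((B⁻¹)ᵀ *ᵥ x) ⬝ᵥ ((B⁻¹)ᵀ *ᵥ x) := fun x => by
    rw [Matrix.mul_inv_rev, ← mulVec_mulVec, dotProduct_mulVec, ← mulVec_transpose,
      ← transpose_nonsing_inv]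
  have h3 := hS.mul_le_sq_of_forall_le (hi1.trans hin) (u := B⁻¹ *ᵥ w) (a := a ^ 2) (b := b ^ 2)
    (fun h => hw (by rw [← hBw, h, mulVec_zero])) (by positivity)
    (fun z hz => by
      rw [hdot, hBw] at hz
      rw [hdot]
      exact hM _ ⟨z, rfl⟩ hz)
    (fun k hk => by
      rw [hdot']
      refine hN _ (inv_transpose_mulVec_mem_polarLattice hd k) ?_
      rwa [dotProduct_mulVec, ← mulVec_transpose] at hk)
  rw [← mul_pow] at h3
  exact le_of_sq_le_sq h3 (Nat.cast_nonneg n)
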